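/- Let k ≥ 1, let q₁, …, q_k ∈ (0,∞) all be different from 1, and let r ∈ (0,4]. Then the generalized q-deformed logistic map Φ_{q_k,…,q₁,r} = φ_{q_k} ∘ ⋯ ∘ φ_{q₁} ∘ f_r is unimodal with unique turning point 1/2: it sends 0 and 1 to 0, is strictly increasing on [0,1/2], and is strictly decreasing on [1/2,1]. -/

import Mathlib

open Real Set Filter

/-- The q-deformation φ_q(x) = (1 - q^x)/(1 - q). -/
noncomputable def phi (q x : ℝ) : ℝ := (1 - q ^ x) / (1 - q)

/-- The logistic map f_r(x) = r·x·(1-x). -/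
noncomputable def logistic (r x : ℝ) : ℝ := r * x * (1 - x)

/-- The generalized q-deformed logistic map
`Φ_{q_k,…,q₁,r} = φ_{q_k} ∘ ⋯ ∘ φ_{q₁} ∘ f_r`, where `qs = [q₁, …, q_k]`. -/
noncomputable def PhiGen (qs : List ℝ) (r x : ℝ) : ℝ :=
  qs.foldl (fun y q => phi q y) (logistic r x)

theorem phi_zero_right (q : ℝ) : phi q 0 = 0 := by
  simp [phi]

theorem phi_strictMono {q : ℝ} (hq : 0 < q) (hq1 : q ≠ 1) : StrictMono (phi q) := by
  intro x y hxy
  unfold phi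
  rcases hq1.lt_or_gt with h | h
  · have := Real.rpow_lt_rpow_of_exponent_gt hq h hxy
    exact div_lt_div_of_pos_right (by linarith) (by linarith)
  · have := Real.rpow_lt_rpow_of_exponent_lt h hxy
    exact div_lt_div_of_neg_of_lt (by linarith) (by linarith)

theorem foldl_phi_zero (qs : List ℝ) : qs.foldl (fun y q => phi q y) 0 = 0 := by
  induction qs with
  | nil => rfl
  | cons q qs ih => simpa [phi_zero_right] using ih

theorem foldl_phi_strictMono (qs : List ℝ) (hqs : ∀ q ∈ qs, 0 < q ∧ q ≠ 1) :
    StrictMono fun x : ℝ => qs.foldl (fun y q => phi q y) x := by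
  induction qs with
  | nil => exact strictMono_id
  | cons q qs ih =>
    have hq := hqs q List.mem_cons_self
    exact (ih fun p hp => hqs p (List.mem_cons_of_mem q hp)).comp (phi_strictMono hq.1 hq.2)

theorem logistic_strictMonoOn {r : ℝ} (hr : 0 < r) :
    StrictMonoOn (logistic r) (Set.Icc 0 (1/2)) := by
  intro x hx y hy hxy
  have : 0 < r * ((y - x) * (1 - x - y)) :=
    mul_pos hr (mul_pos (by linarith) (by linarith [hy.2]))
  unfold logistic
  linarith

theorem logistic_strictAntiOn {r : ℝ} (hr : 0 < r) :
    StrictAntiOn (logistic r) (Set.Icc (1/2) 1) := by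
  intro x hx y hy hxy
  have : 0 < r * ((y - x) * (x + y - 1)) :=
    mul_pos hr (mul_pos (by linarith) (by linarith [hx.1]))
  unfold logistic
  linarith

/-- For `k ≥ 1`, `q₁, …, q_k ∈ (0,∞)` all `≠ 1`, and `r ∈ (0,4]`, the generalized
q-deformed logistic map `Φ_{q_k,…,q₁,r}` is unimodal with unique turning point `1/2`:
it sends `0` and `1` to `0`, is strictly increasing on `[0,1/2]` and strictly decreasing
on `[1/2,1]`. -/
theorem stmt_19 (qs : List ℝ) (hk : qs ≠ []) (hqs : ∀ q ∈ qs, 0 < q ∧ q ≠ 1)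
    (r : ℝ) (hr : 0 < r) (hr4 : r ≤ 4) :
    PhiGen qs r 0 = 0 ∧ PhiGen qs r 1 = 0 ∧
    StrictMonoOn (PhiGen qs r) (Set.Icc 0 (1/2)) ∧
    StrictAntiOn (PhiGen qs r) (Set.Icc (1/2) 1) := by
  have hmono := foldl_phi_strictMono qs hqs
  refine ⟨?_, ?_, fun x hx y hy hxy => hmono (logistic_strictMonoOn hr hx hy hxy),
    fun x hx y hy hxy => hmono (logistic_strictAntiOn hr hx hy hxy)⟩
  · simpa [PhiGen, logistic] using foldl_phi_zero qs
  · simpa [PhiGen, logistic] using foldl_phi_zero qs
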